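/- For all n ≥ 2 and d ≥ 1 there exists δ(n,d) > 0 with the following property: if h : ℝⁿ → ℝ is a harmonic polynomial of degree d with h(x) = 0 and θ_{Σ_h}(x,r) < δ(n,d) for some r > 0, then ζ_1(h,x,r) < δ(n,d)^{-1}; in particular Dh(x) ≠ 0. -/

import Mathlib

open MvPolynomial Metric Filter
open scoped ENNReal

/-- Evaluate a multivariate polynomial at a point of Euclidean space. -/
noncomputable def evalPt {n : ℕ} (p : MvPolynomial (Fin n) ℝ)
    (y : EuclideanSpace ℝ (Fin n)) : ℝ :=
  MvPolynomial.eval (fun i => y i) p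

/-- The zero set of a polynomial. -/
def zeroSet {n : ℕ} (p : MvPolynomial (Fin n) ℝ) : Set (EuclideanSpace ℝ (Fin n)) :=
  {y | evalPt p y = 0}

/-- The polynomial y ↦ p(y + x). -/
noncomputable def translatePoly {n : ℕ} (p : MvPolynomial (Fin n) ℝ)
    (x : EuclideanSpace ℝ (Fin n)) : MvPolynomial (Fin n) ℝ :=
  MvPolynomial.bind₁ (fun i => MvPolynomial.X i + MvPolynomial.C (x i)) p

/-- The homogeneous part of degree `k` of `p` centered at `x`. -/
noncomputable def homPart {n : ℕ} (p : MvPolynomial (Fin n) ℝ)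
    (x : EuclideanSpace ℝ (Fin n)) (k : ℕ) : MvPolynomial (Fin n) ℝ :=
  MvPolynomial.homogeneousComponent k (translatePoly p x)

/-- The sup norm of |q| on the closed ball B(0,r), as an extended nonnegative real. -/
noncomputable def supNormBall {n : ℕ} (q : MvPolynomial (Fin n) ℝ) (r : ℝ) : ℝ≥0∞ :=
  ⨆ y ∈ Metric.closedBall (0 : EuclideanSpace ℝ (Fin n)) r, ENNReal.ofReal |evalPt q y|

/-- ζ_k(p,x,r): the relative size of the homogeneous part of degree k of a polynomial of
degree d, centered at x, on the ball of radius r. -/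
noncomputable def zeta {n : ℕ} (d : ℕ) (p : MvPolynomial (Fin n) ℝ)
    (x : EuclideanSpace ℝ (Fin n)) (k : ℕ) (r : ℝ) : ℝ≥0∞ :=
  ⨆ j ∈ (Finset.range (d + 1)).erase k,
    supNormBall (homPart p x j) r / supNormBall (homPart p x k) r

/-- A polynomial is harmonic if its Laplacian vanishes. -/
def IsHarmonic {n : ℕ} (p : MvPolynomial (Fin n) ℝ) : Prop :=
  ∑ i : Fin n, MvPolynomial.pderiv i (MvPolynomial.pderiv i p) = 0

/-- The local flatness θ_Σ(x,r): the normalized minimal Hausdorff distance between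
Σ ∩ B(x,r) and (x + L) ∩ B(x,r) over hyperplanes L through the origin. -/
noncomputable def flatness {n : ℕ} (A : Set (EuclideanSpace ℝ (Fin n)))
    (x : EuclideanSpace ℝ (Fin n)) (r : ℝ) : ℝ :=
  (1 / r) * ⨅ L : {L : Submodule ℝ (EuclideanSpace ℝ (Fin n)) // Module.finrank ℝ L = n - 1},
    Metric.hausdorffDist (A ∩ Metric.closedBall x r)
      (((fun y => x + y) '' (L.1 : Set (EuclideanSpace ℝ (Fin n)))) ∩ Metric.closedBall x r)

/-- Dp(x) ≠ 0 : some partial derivative of p is nonzero at x. -/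
def gradNeZero {n : ℕ} (p : MvPolynomial (Fin n) ℝ) (x : EuclideanSpace ℝ (Fin n)) : Prop :=
  ∃ i : Fin n, MvPolynomial.eval (fun j => x j) (MvPolynomial.pderiv i p) ≠ 0

/-- Sup of |h| on the unit sphere. -/
noncomputable def sphereSup {n : ℕ} (h : MvPolynomial (Fin n) ℝ) : ℝ :=
  sSup ((fun θ => |evalPt h θ|) '' Metric.sphere (0 : EuclideanSpace ℝ (Fin n)) 1)

/-- The polynomial y ↦ p(t·y). -/
noncomputable def dilatePoly {n : ℕ} (p : MvPolynomial (Fin n) ℝ) (t : ℝ) :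
    MvPolynomial (Fin n) ℝ :=
  MvPolynomial.bind₁ (fun i => MvPolynomial.C t * MvPolynomial.X i) p

section GaussianExpectation

open MeasureTheory ProbabilityTheory

/-- Every power is integrable against the standard Gaussian. -/
lemma integrable_pow_gaussianReal (k : ℕ) :
    Integrable (fun x : ℝ => x ^ k) (gaussianReal 0 1) := by
  have h := (memLp_id_gaussianReal (μ := 0) (v := 1) (k : NNReal)).integrable_norm_pow'
  refine h.mono' (by fun_prop) (ae_of_all _ fun x => ?_)
  simp

lemma hasDerivAt_gaussianPDFReal (x : ℝ) :
    HasDerivAt (gaussianPDFReal 0 1) (-x * gaussianPDFReal 0 1 x) x := by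
  have h : HasDerivAt (fun y : ℝ => (√(2 * Real.pi * (1 : NNReal)))⁻¹ *
      Real.exp (-(y - 0) ^ 2 / (2 * (1 : NNReal)))) _ x :=
    ((((((hasDerivAt_id x).sub_const 0).pow 2).neg.div_const
      (2 * ((1 : NNReal) : ℝ))).exp).const_mul _)
  refine h.congr_deriv ?_
  simp [gaussianPDFReal]
  ring

/-- Gaussian integration by parts for powers. -/
lemma integral_pow_succ_gaussianReal (k : ℕ) :
    ∫ x, x ^ (k + 1) ∂(gaussianReal 0 1) = k * ∫ x, x ^ (k - 1) ∂(gaussianReal 0 1) := by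
  have hint : ∀ j : ℕ, Integrable (fun x : ℝ => gaussianPDFReal 0 1 x * x ^ j) := by
    intro j
    have h := integrable_pow_gaussianReal j
    rw [gaussianReal_of_var_ne_zero _ one_ne_zero,
      integrable_withDensity_iff_integrable_smul' (measurable_gaussianPDF _ _)
        (ae_of_all _ fun _ => gaussianPDF_lt_top)] at h
    simpa [toReal_gaussianPDF] using h
  have hderiv : ∀ x : ℝ, HasDerivAt (fun x => gaussianPDFReal 0 1 x * x ^ k)
      (k * (gaussianPDFReal 0 1 x * x ^ (k - 1)) - gaussianPDFReal 0 1 x * x ^ (k + 1)) x := by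
    intro x
    refine ((hasDerivAt_gaussianPDFReal x).mul (hasDerivAt_pow k x)).congr_deriv ?_
    ring
  have h0 := integral_eq_zero_of_hasDerivAt_of_integrable hderiv
    (((hint (k - 1)).const_mul _).sub (hint (k + 1))) (hint k)
  rw [integral_sub ((hint (k - 1)).const_mul _) (hint (k + 1)), integral_const_mul] at h0
  rw [integral_gaussianReal_eq_integral_smul one_ne_zero,
    integral_gaussianReal_eq_integral_smul one_ne_zero]
  simp only [smul_eq_mul]
  linarith

/-- The standard Gaussian measure on `Fin n → ℝ`. -/
noncomputable def gaussianPi (n : ℕ) : Measure (Fin n → ℝ) :=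
  Measure.pi fun _ => gaussianReal 0 1

instance (n : ℕ) : (gaussianPi n).IsOpenPosMeasure := by
  have : (gaussianReal 0 1).IsOpenPosMeasure :=
    (gaussianReal_absolutelyContinuous' 0 one_ne_zero).isOpenPosMeasure
  unfold gaussianPi
  infer_instance

lemma eval_monomial_eq_prod {n : ℕ} (a : Fin n →₀ ℕ) (c : ℝ) (y : Fin n → ℝ) :
    eval y (monomial a c) = c * ∏ i, y i ^ a i := by
  rw [eval_monomial, Finsupp.prod_fintype _ _ (by simp)]

lemma integrable_eval_gaussianPi {n : ℕ} (f : MvPolynomial (Fin n) ℝ) :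
    Integrable (fun y => eval y f) (gaussianPi n) := by
  induction f using MvPolynomial.induction_on' with
  | monomial a c =>
    simp only [eval_monomial_eq_prod]
    exact (Integrable.fintype_prod_dep (f := fun i (x : ℝ) => x ^ a i)
      fun i => integrable_pow_gaussianReal (a i)).const_mul c
  | add p q hp hq =>
    simp only [map_add]
    exact hp.add hq

/-- The expectation of a polynomial in independent standard Gaussian variables. -/
noncomputable def gaussianExp {n : ℕ} (f : MvPolynomial (Fin n) ℝ) : ℝ :=
  ∫ y, eval y f ∂(gaussianPi n)

lemma gaussianExp_add {n : ℕ} (f g : MvPolynomial (Fin n) ℝ) :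
    gaussianExp (f + g) = gaussianExp f + gaussianExp g := by
  simp only [gaussianExp, map_add]
  exact integral_add (integrable_eval_gaussianPi f) (integrable_eval_gaussianPi g)

lemma gaussianExp_sum {n : ℕ} {ι : Type*} (s : Finset ι) (f : ι → MvPolynomial (Fin n) ℝ) :
    gaussianExp (∑ i ∈ s, f i) = ∑ i ∈ s, gaussianExp (f i) := by
  simp only [gaussianExp, map_sum]
  exact integral_finsetSum _ fun i _ => integrable_eval_gaussianPi (f i)

lemma gaussianExp_C_mul {n : ℕ} (c : ℝ) (f : MvPolynomial (Fin n) ℝ) :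
    gaussianExp (C c * f) = c * gaussianExp f := by
  simp only [gaussianExp, map_mul, eval_C]
  exact integral_const_mul _ _

lemma gaussianExp_monomial {n : ℕ} (a : Fin n →₀ ℕ) (c : ℝ) :
    gaussianExp (monomial a c) = c * ∏ i, ∫ x, x ^ a i ∂(gaussianReal 0 1) := by
  simp only [gaussianExp, eval_monomial_eq_prod]
  rw [integral_const_mul]
  congr 1
  exact integral_fintype_prod_eq_prod (fun i (x : ℝ) => x ^ a i)

/-- Gaussian integration by parts for polynomials. -/
lemma gaussianExp_X_mul {n : ℕ} (i : Fin n) (f : MvPolynomial (Fin n) ℝ) :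
    gaussianExp (X i * f) = gaussianExp (pderiv i f) := by
  induction f using MvPolynomial.induction_on' with
  | monomial a c =>
    rw [pderiv_monomial, X, monomial_mul, gaussianExp_monomial, gaussianExp_monomial,
      ← Finset.mul_prod_erase _ _ (Finset.mem_univ i),
      ← Finset.mul_prod_erase Finset.univ (fun j => ∫ x, x ^ ((a - Finsupp.single i 1 : Fin n →₀ ℕ) j)
        ∂(gaussianReal 0 1)) (Finset.mem_univ i)]
    have h : ∀ j ∈ Finset.univ.erase i,
        ∫ x, x ^ ((Finsupp.single i 1 + a : Fin n →₀ ℕ) j) ∂(gaussianReal 0 1)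
          = ∫ x, x ^ ((a - Finsupp.single i 1 : Fin n →₀ ℕ) j) ∂(gaussianReal 0 1) := by
      intro j hj
      simp [(Finset.ne_of_mem_erase hj).symm]
    rw [Finset.prod_congr rfl h]
    simp only [Finsupp.add_apply, Finsupp.tsub_apply, Finsupp.single_eq_same]
    rw [add_comm 1 (a i), integral_pow_succ_gaussianReal]
    ring
  | add p q hp hq => rw [mul_add, gaussianExp_add, hp, hq, map_add, gaussianExp_add]

lemma eq_zero_of_gaussianExp_eq_zero {n : ℕ} {f : MvPolynomial (Fin n) ℝ}
    (hf : ∀ y, 0 ≤ eval y f) (h : gaussianExp f = 0) : f = 0 := by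
  have h1 := (integral_eq_zero_iff_of_nonneg (fun y => hf y) (integrable_eval_gaussianPi f)).1 h
  have h2 := (MvPolynomial.continuous_eval f).ae_eq_iff_eq (gaussianPi n) continuous_zero |>.1 h1
  exact MvPolynomial.funext fun y => by simpa using congrFun h2 y

/-- Homogeneous harmonic polynomials of positive degree have zero Gaussian mean. -/
lemma gaussianExp_eq_zero_of_isHarmonic {n m : ℕ} (hm : 1 ≤ m) {q : MvPolynomial (Fin n) ℝ}
    (hq : q.IsHomogeneous m) (hh : IsHarmonic q) : gaussianExp q = 0 := by
  have h := congrArg gaussianExp hq.sum_X_mul_pderiv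
  rw [gaussianExp_sum] at h
  simp only [gaussianExp_X_mul] at h
  rw [← gaussianExp_sum, show ∑ i : Fin n, pderiv i (pderiv i q) = 0 from hh, nsmul_eq_mul,
    ← map_natCast (C : ℝ →+* MvPolynomial (Fin n) ℝ), gaussianExp_C_mul] at h
  have h0 : gaussianExp (0 : MvPolynomial (Fin n) ℝ) = 0 := by simp [gaussianExp]
  rw [h0] at h
  have : (m : ℝ) ≠ 0 := by positivity
  exact (mul_eq_zero.1 h.symm).resolve_left this

lemma pderiv_comm' {n : ℕ} (i j : Fin n) (q : MvPolynomial (Fin n) ℝ) :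
    pderiv i (pderiv j q) = pderiv j (pderiv i q) := by
  ext a
  simp only [coeff_pderiv]
  by_cases h : i = j
  · subst h; rfl
  · rw [add_right_comm]
    simp [h, Ne.symm h, mul_right_comm]

lemma IsHarmonic.pderiv {n : ℕ} {q : MvPolynomial (Fin n) ℝ} (hh : IsHarmonic q) (i : Fin n) :
    IsHarmonic (MvPolynomial.pderiv i q) := by
  have h := congrArg (MvPolynomial.pderiv i) hh
  rw [map_sum, map_zero] at h
  rw [IsHarmonic, ← h]
  refine Finset.sum_congr rfl fun j _ => ?_
  rw [pderiv_comm' j i q, pderiv_comm' j i]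

/-- A homogeneous harmonic polynomial of degree at least two which has a fixed sign on each side
of a hyperplane vanishes. -/
lemma eq_zero_of_sign {n m : ℕ} (hm : 2 ≤ m) {q : MvPolynomial (Fin n) ℝ}
    (hq : q.IsHomogeneous m) (hh : IsHarmonic q) (e : Fin n → ℝ)
    (hpos : ∀ y y' : Fin n → ℝ, 0 ≤ ∑ i, e i * y i → 0 ≤ ∑ i, e i * y' i →
      0 ≤ eval y q * eval y' q)
    (hneg : ∀ y y' : Fin n → ℝ, ∑ i, e i * y i ≤ 0 → ∑ i, e i * y' i ≤ 0 →
      0 ≤ eval y q * eval y' q) : q = 0 := by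
  have key : ∀ P : (Fin n → ℝ) → Prop, (∀ y y', P y → P y' → 0 ≤ eval y q * eval y' q) →
      (∀ y, P y → 0 ≤ eval y q) ∨ (∀ y, P y → eval y q ≤ 0) := by
    intro P hP
    by_contra! hcon
    obtain ⟨⟨y, hy, hy0⟩, y', hy', hy0'⟩ := hcon
    nlinarith [hP y y' hy hy']
  have hE := gaussianExp_eq_zero_of_isHarmonic (by omega) hq hh
  have hEneg : gaussianExp (C (-1) * q) = 0 := by rw [gaussianExp_C_mul, hE, mul_zero]
  set l : MvPolynomial (Fin n) ℝ := ∑ i, C (e i) * X i with hl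
  have hleval : ∀ y, eval y l = ∑ i, e i * y i := by simp [hl]
  have hEl : gaussianExp (l * q) = 0 := by
    rw [hl, Finset.sum_mul, gaussianExp_sum]
    refine Finset.sum_eq_zero fun i _ => ?_
    rw [mul_assoc, gaussianExp_C_mul, gaussianExp_X_mul,
      gaussianExp_eq_zero_of_isHarmonic (by omega) hq.pderiv (hh.pderiv i), mul_zero]
  have hElneg : gaussianExp (C (-1) * (l * q)) = 0 := by rw [gaussianExp_C_mul, hEl, mul_zero]
  have hl0 : l * q = 0 → q = 0 := by
    intro h
    rcases mul_eq_zero.1 h with h | h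
    · have hz : ∀ y : Fin n → ℝ, ∑ i, e i * y i = 0 := fun y => by rw [← hleval, h, map_zero]
      rcases key (fun _ => True) fun y y' _ _ => hpos y y' (hz y).ge (hz y').ge with hs | hs
      · exact eq_zero_of_gaussianExp_eq_zero (fun y => hs y trivial) hE
      · have := eq_zero_of_gaussianExp_eq_zero (f := C (-1) * q)
          (fun y => by simpa using hs y trivial) hEneg
        simpa using this
    · exact h
  rcases key _ hpos with h1 | h1 <;> rcases key _ hneg with h2 | h2
  · refine eq_zero_of_gaussianExp_eq_zero (fun y => ?_) hE
    rcases le_total 0 (∑ i, e i * y i) with h | h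
    exacts [h1 y h, h2 y h]
  · refine hl0 (eq_zero_of_gaussianExp_eq_zero (fun y => ?_) hEl)
    rw [map_mul, hleval]
    rcases le_total 0 (∑ i, e i * y i) with h | h
    exacts [mul_nonneg h (h1 y h), mul_nonneg_of_nonpos_of_nonpos h (h2 y h)]
  · refine hl0 ?_
    have := eq_zero_of_gaussianExp_eq_zero (f := C (-1) * (l * q)) (fun y => ?_) hElneg
    · simpa using this
    rw [map_mul, map_mul, hleval, eval_C]
    rcases le_total 0 (∑ i, e i * y i) with h | h
    · nlinarith [h1 y h]
    · nlinarith [h2 y h]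
  · have := eq_zero_of_gaussianExp_eq_zero (f := C (-1) * q) (fun y => ?_) hEneg
    · simpa using this
    rw [map_mul, eval_C]
    rcases le_total 0 (∑ i, e i * y i) with h | h
    · linarith [h1 y h]
    · linarith [h2 y h]

end GaussianExpectation

section AffineSubstitution

variable {n : ℕ}

lemma evalPt_translatePoly (p : MvPolynomial (Fin n) ℝ) (x y : EuclideanSpace ℝ (Fin n)) :
    evalPt (translatePoly p x) y = evalPt p (x + y) := by
  simp only [evalPt, translatePoly]
  rw [← MvPolynomial.coe_aeval_eq_eval, RingHom.coe_coe, aeval_bind₁,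
    ← MvPolynomial.coe_aeval_eq_eval, RingHom.coe_coe]
  simp [add_comm]

lemma evalPt_dilatePoly (p : MvPolynomial (Fin n) ℝ) (t : ℝ) (y : EuclideanSpace ℝ (Fin n)) :
    evalPt (dilatePoly p t) y = evalPt p (t • y) := by
  simp only [evalPt, dilatePoly]
  rw [← MvPolynomial.coe_aeval_eq_eval, RingHom.coe_coe, aeval_bind₁,
    ← MvPolynomial.coe_aeval_eq_eval, RingHom.coe_coe]
  simp

lemma pderiv_translatePoly (p : MvPolynomial (Fin n) ℝ) (x : EuclideanSpace ℝ (Fin n))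
    (i : Fin n) : pderiv i (translatePoly p x) = translatePoly (pderiv i p) x := by
  unfold translatePoly
  induction p using MvPolynomial.induction_on with
  | C a => simp
  | add p q hp hq => simp [hp, hq]
  | mul_X p j hp =>
    rw [map_mul, pderiv_mul, hp, pderiv_mul, map_add, map_mul, map_mul, bind₁_X_right]
    by_cases h : j = i
    · subst h; simp
    · simp [pderiv_X_of_ne h]

lemma IsHarmonic.translatePoly {p : MvPolynomial (Fin n) ℝ} (hp : IsHarmonic p)
    (x : EuclideanSpace ℝ (Fin n)) : IsHarmonic (translatePoly p x) := by
  unfold IsHarmonic at hp ⊢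
  simp only [pderiv_translatePoly]
  have h := congrArg (fun q => _root_.translatePoly q x) hp
  simpa [_root_.translatePoly] using h

lemma totalDegree_translatePoly_le (p : MvPolynomial (Fin n) ℝ) (x : EuclideanSpace ℝ (Fin n)) :
    (translatePoly p x).totalDegree ≤ p.totalDegree := by
  have h : translatePoly p x = ∑ a ∈ p.support, bind₁
      (fun i => X i + C (x i) : Fin n → MvPolynomial (Fin n) ℝ) (monomial a (coeff a p)) := by
    conv_lhs => rw [translatePoly, p.as_sum]
    rw [map_sum]
  rw [h]
  refine totalDegree_finsetSum_le fun a ha => ?_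
  rw [bind₁_monomial]
  refine (totalDegree_mul _ _).trans ?_
  rw [totalDegree_C, zero_add]
  refine (totalDegree_finsetProd _ _).trans (le_trans ?_ (le_totalDegree ha))
  refine Finset.sum_le_sum fun i _ => (totalDegree_pow _ _).trans ?_
  have : (X i + C (x i) : MvPolynomial (Fin n) ℝ).totalDegree ≤ 1 := by
    refine (totalDegree_add _ _).trans ?_
    simp
  nlinarith

lemma coeff_dilatePoly (p : MvPolynomial (Fin n) ℝ) (t : ℝ) (a : Fin n →₀ ℕ) :
    coeff a (dilatePoly p t) = t ^ a.degree * coeff a p := by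
  unfold dilatePoly
  induction p using MvPolynomial.induction_on' with
  | monomial b c =>
    have h : bind₁ (fun i => C t * X i : Fin n → MvPolynomial (Fin n) ℝ) (monomial b c)
        = C (t ^ b.degree) * monomial b c := by
      rw [bind₁_monomial, monomial_eq, Finsupp.degree_apply, Finsupp.prod]
      simp only [mul_pow, Finset.prod_mul_distrib, ← C_pow]
      rw [← map_prod, Finset.prod_pow_eq_pow_sum]
      ring
    rw [h, coeff_C_mul, coeff_monomial]
    split_ifs with hb
    · rw [hb]
    · simp
  | add p q hp hq => rw [map_add, coeff_add, hp, hq, coeff_add, mul_add]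

lemma IsHarmonic.dilatePoly {p : MvPolynomial (Fin n) ℝ} (hp : IsHarmonic p) (t : ℝ) :
    IsHarmonic (dilatePoly p t) := by
  ext b
  have h := congrArg (coeff b) hp
  rw [coeff_sum, coeff_zero] at h ⊢
  simp only [coeff_pderiv, coeff_dilatePoly] at h ⊢
  rw [← mul_zero (t ^ (b.degree + 2)), ← h, Finset.mul_sum]
  refine Finset.sum_congr rfl fun i _ => ?_
  simp only [map_add, Finsupp.degree_single]
  ring

end AffineSubstitution

section BlowUp

open scoped Topology

variable {n : ℕ}

lemma IsHarmonic.homogeneousComponent {g : MvPolynomial (Fin n) ℝ} (hg : IsHarmonic g) (m : ℕ) :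
    IsHarmonic (homogeneousComponent m g) := by
  ext b
  have h := congrArg (coeff b) hg
  rw [coeff_sum, coeff_zero] at h ⊢
  simp only [coeff_pderiv, coeff_homogeneousComponent, map_add, Finsupp.degree_single] at h ⊢
  by_cases hb : b.degree + 1 + 1 = m
  · simpa [hb] using h
  · simp [hb]

/-- The lowest order homogeneous part of `g` is the limit of rescalings of `g` along rays. -/
lemma tendsto_homogeneousComponent_of_coeff_eq_zero {g : MvPolynomial (Fin n) ℝ} {m : ℕ}
    (hm : ∀ a ∈ g.support, m ≤ a.degree) (y : Fin n → ℝ) :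
    Tendsto (fun t : ℝ => (t ^ m)⁻¹ * eval (t • y) g) (𝓝[>] 0)
      (𝓝 (eval y (homogeneousComponent m g))) := by
  set F : ℝ → ℝ := fun t => ∑ a ∈ g.support, coeff a g * t ^ (a.degree - m) * ∏ i, y i ^ a i
    with hF
  have hcont : Continuous F := by fun_prop
  have h0 : F 0 = eval y (homogeneousComponent m g) := by
    rw [homogeneousComponent_apply, map_sum, Finset.sum_filter, hF]
    refine Finset.sum_congr rfl fun a ha => ?_
    have := hm a ha
    split_ifs with h
    · rw [eval_monomial_eq_prod, h]; simp
    · rw [zero_pow (by omega)]; simp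
  rw [← h0]
  refine ((hcont.tendsto 0).mono_left nhdsWithin_le_nhds).congr' ?_
  filter_upwards [self_mem_nhdsWithin] with t ht
  have ht : 0 < t := ht
  rw [eval_eq', Finset.mul_sum]
  refine Finset.sum_congr rfl fun a ha => ?_
  have h1 : t ^ a.degree = t ^ m * t ^ (a.degree - m) := by
    rw [← pow_add, Nat.add_sub_cancel' (hm a ha)]
  have h2 : ∏ i, (t • y) i ^ a i = t ^ a.degree * ∏ i, y i ^ a i := by
    simp only [Pi.smul_apply, smul_eq_mul, mul_pow, Finset.prod_mul_distrib]
    rw [Finset.prod_pow_eq_pow_sum, Finsupp.degree_eq_sum]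
  rw [h2, h1]
  field_simp

/-- A harmonic polynomial vanishing to second order at the origin whose sign near the origin
depends only on the side of a hyperplane is zero. -/
lemma eq_zero_of_eventually_sign {g : MvPolynomial (Fin n) ℝ} (hg : IsHarmonic g)
    (hlow : ∀ a : Fin n →₀ ℕ, a.degree ≤ 1 → coeff a g = 0) {e : Fin n → ℝ} (he : e ≠ 0)
    (hs : ∀ y y' : Fin n → ℝ, 0 < (∑ i, e i * y i) * (∑ i, e i * y' i) →
      ∀ᶠ t : ℝ in 𝓝[>] 0, 0 ≤ eval (t • y) g * eval (t • y') g) : g = 0 := by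
  by_contra hne
  obtain ⟨a, ha, hmin⟩ := g.support.exists_min_image (fun a => a.degree)
    (Finset.nonempty_iff_ne_empty.2 (by simpa using hne))
  set m := a.degree with hm
  set q := homogeneousComponent m g with hq
  have hm2 : 2 ≤ m := by
    by_contra hcon
    exact mem_support_iff.1 ha (hlow a (by omega))
  have hstrict : ∀ y y' : Fin n → ℝ, 0 < (∑ i, e i * y i) * (∑ i, e i * y' i) →
      0 ≤ eval y q * eval y' q := by
    intro y y' h
    refine ge_of_tendsto ((tendsto_homogeneousComponent_of_coeff_eq_zero hmin y).mul
      (tendsto_homogeneousComponent_of_coeff_eq_zero hmin y')) ?_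
    filter_upwards [hs y y' h, self_mem_nhdsWithin] with t ht ht0
    have : 0 ≤ (t ^ m)⁻¹ * (t ^ m)⁻¹ := mul_self_nonneg _
    calc 0 ≤ ((t ^ m)⁻¹ * (t ^ m)⁻¹) * (eval (t • y) g * eval (t • y') g) := mul_nonneg this ht
      _ = _ := by ring
  have hee : 0 < ∑ i, e i * e i := by
    obtain ⟨i, hi⟩ := Function.ne_iff.1 he
    exact Finset.sum_pos' (fun j _ => mul_self_nonneg _)
      ⟨i, Finset.mem_univ i, mul_self_pos.2 hi⟩
  have hsum : ∀ (y : Fin n → ℝ) (s : ℝ),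
      ∑ i, e i * (y + s • e) i = ∑ i, e i * y i + s * ∑ i, e i * e i := by
    intro y s
    rw [Finset.mul_sum, ← Finset.sum_add_distrib]
    refine Finset.sum_congr rfl fun i _ => ?_
    simp only [Pi.add_apply, Pi.smul_apply, smul_eq_mul]
    ring
  have hlim : ∀ (σ : ℝ) (y y' : Fin n → ℝ),
      (∀ s : ℝ, 0 < s → 0 < (∑ i, e i * (y + (s * σ) • e) i) *
        (∑ i, e i * (y' + (s * σ) • e) i)) → 0 ≤ eval y q * eval y' q := by
    intro σ y y' h
    have hc : Continuous fun s : ℝ => eval (y + (s * σ) • e) q * eval (y' + (s * σ) • e) q :=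
      ((MvPolynomial.continuous_eval q).comp (by fun_prop)).mul
        ((MvPolynomial.continuous_eval q).comp (by fun_prop))
    have ht := (hc.tendsto 0).mono_left (nhdsWithin_le_nhds (s := Set.Ioi 0))
    simp only [zero_mul, zero_smul, add_zero] at ht
    refine ge_of_tendsto ht ?_
    filter_upwards [self_mem_nhdsWithin] with s hs0
    exact hstrict _ _ (h s hs0)
  have hq0 : q = 0 := by
    refine eq_zero_of_sign hm2 (homogeneousComponent_isHomogeneous m g)
      (hg.homogeneousComponent m) e (fun y y' hy hy' => hlim 1 y y' fun s hs0 => ?_)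
      (fun y y' hy hy' => hlim (-1) y y' fun s hs0 => ?_)
    · rw [hsum, hsum]
      exact mul_pos (by nlinarith) (by nlinarith)
    · rw [hsum, hsum]
      exact mul_pos_of_neg_of_neg (by nlinarith) (by nlinarith)
  have := congrArg (coeff a) hq0
  rw [hq, coeff_homogeneousComponent, if_pos hm.symm, coeff_zero] at this
  exact mem_support_iff.1 ha this

/-- A harmonic polynomial vanishing to second order at the origin whose sign in the unit ball
depends only on the side of a hyperplane is zero. -/
lemma eq_zero_of_sign_on_ball {g : MvPolynomial (Fin n) ℝ} (hg : IsHarmonic g)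
    (hlow : ∀ a : Fin n →₀ ℕ, a.degree ≤ 1 → coeff a g = 0)
    {e : EuclideanSpace ℝ (Fin n)} (he : ‖e‖ = 1)
    (hs : ∀ y y' : EuclideanSpace ℝ (Fin n), ‖y‖ ≤ 1 → ‖y'‖ ≤ 1 →
      0 < inner ℝ e y * inner ℝ e y' → 0 ≤ evalPt g y * evalPt g y') : g = 0 := by
  have hinner : ∀ y : Fin n → ℝ, inner ℝ e (WithLp.toLp 2 y) = ∑ i, e i * y i := by
    intro y
    rw [PiLp.inner_apply]
    simp [mul_comm]
  have hsmall : ∀ z : Fin n → ℝ, ∀ᶠ t : ℝ in 𝓝[>] 0,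
      ‖t • (WithLp.toLp 2 z : EuclideanSpace ℝ (Fin n))‖ ≤ 1 := by
    intro z
    have hcz : Continuous fun t : ℝ => ‖t • (WithLp.toLp 2 z : EuclideanSpace ℝ (Fin n))‖ := by
      fun_prop
    have := (hcz.tendsto 0).mono_left (nhdsWithin_le_nhds (s := Set.Ioi 0))
    simp only [zero_smul, norm_zero] at this
    exact this.eventually_le_const one_pos
  refine eq_zero_of_eventually_sign hg hlow (e := fun i => e i) (fun h => ?_) fun y y' hyy => ?_
  · have h0 : e = 0 := by
      ext i
      exact congrFun h i
    rw [h0, norm_zero] at he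
    exact zero_ne_one he
  · filter_upwards [hsmall y, hsmall y', self_mem_nhdsWithin] with t ht ht' ht0
    have ht0 : 0 < t := ht0
    have h := hs (t • WithLp.toLp 2 y) (t • WithLp.toLp 2 y') ht ht' ?_
    · exact h
    · rw [inner_smul_right, inner_smul_right, hinner, hinner]
      calc 0 < (t * t) * ((∑ i, e i * y i) * ∑ i, e i * y' i) :=
            mul_pos (mul_pos ht0 ht0) hyy
        _ = _ := by ring

lemma continuous_evalPt (p : MvPolynomial (Fin n) ℝ) : Continuous (evalPt p) :=
  (MvPolynomial.continuous_eval p).comp (by fun_prop)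

/-- If the zeros of `p` in the unit ball lie in a slab, `p` has a fixed sign on each side of it. -/
lemma evalPt_mul_nonneg_of_le_inner {p : MvPolynomial (Fin n) ℝ} {e : EuclideanSpace ℝ (Fin n)}
    {ε : ℝ} (hz : ∀ y, ‖y‖ ≤ 1 → evalPt p y = 0 → |inner ℝ e y| < ε)
    {y y' : EuclideanSpace ℝ (Fin n)} (hy : ‖y‖ ≤ 1) (hy' : ‖y'‖ ≤ 1)
    (h : ε ≤ inner ℝ e y) (h' : ε ≤ inner ℝ e y') : 0 ≤ evalPt p y * evalPt p y' := by
  have hconv : Convex ℝ (closedBall (0 : EuclideanSpace ℝ (Fin n)) 1 ∩ {z | ε ≤ inner ℝ e z}) :=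
    (convex_closedBall _ _).inter
      (convex_halfSpace_ge (innerSL ℝ e).isLinear ε)
  have hmem : y ∈ closedBall (0 : EuclideanSpace ℝ (Fin n)) 1 ∩ {z | ε ≤ inner ℝ e z} :=
    ⟨by simpa using hy, h⟩
  have hmem' : y' ∈ closedBall (0 : EuclideanSpace ℝ (Fin n)) 1 ∩ {z | ε ≤ inner ℝ e z} :=
    ⟨by simpa using hy', h'⟩
  have hnot : ∀ z ∈ closedBall (0 : EuclideanSpace ℝ (Fin n)) 1 ∩ {z | ε ≤ inner ℝ e z},
      evalPt p z ≠ 0 := by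
    intro z hz1 hz0
    exact absurd (hz z (by simpa using hz1.1) hz0) (not_lt.2 (hz1.2.trans (le_abs_self _)))
  by_contra! hneg
  rcases mul_neg_iff.1 hneg with ⟨h1, h2⟩ | ⟨h1, h2⟩
  · obtain ⟨z, hz1, hz0⟩ := hconv.isPreconnected.intermediate_value hmem' hmem
      (continuous_evalPt p).continuousOn ⟨h2.le, h1.le⟩
    exact hnot z hz1 hz0
  · obtain ⟨z, hz1, hz0⟩ := hconv.isPreconnected.intermediate_value hmem hmem'
      (continuous_evalPt p).continuousOn ⟨h1.le, h2.le⟩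
    exact hnot z hz1 hz0

end BlowUp

section Compactness

open scoped Topology

variable {n : ℕ}

lemma exists_eq_single_of_degree_eq_one {a : Fin n →₀ ℕ} (ha : a.degree = 1) :
    ∃ i, a = Finsupp.single i 1 := by
  have hne : a ≠ 0 := by rintro rfl; simp at ha
  obtain ⟨i, hi⟩ := Finsupp.ne_iff.1 hne
  have hle : Finsupp.single i 1 ≤ a := by
    rw [Finsupp.single_le_iff]
    exact Nat.one_le_iff_ne_zero.2 hi
  have hadd := congrArg Finsupp.degree (add_tsub_cancel_of_le hle)
  rw [map_add, Finsupp.degree_single, ha] at hadd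
  have h0 : a - Finsupp.single i 1 = 0 := (Finsupp.degree_eq_zero_iff _).1 (by omega)
  exact ⟨i, le_antisymm (tsub_eq_zero_iff_le.1 h0) hle⟩

/-- Exponents of monomials of degree at most `d`. -/
abbrev ExponentLE (n d : ℕ) : Type := {a : Fin n →₀ ℕ // a.degree ≤ d}

noncomputable instance (n d : ℕ) : Fintype (ExponentLE n d) :=
  (Finsupp.finite_of_degree_le (σ := Fin n) d).fintype

/-- The polynomial with prescribed coefficients in degrees at most `d`. -/
noncomputable def ofCoeffs (n d : ℕ) : (ExponentLE n d → ℝ) →ₗ[ℝ] MvPolynomial (Fin n) ℝ :=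
  ∑ a : ExponentLE n d, (monomial a.1).comp (LinearMap.proj a)

lemma coeff_ofCoeffs {d : ℕ} (c : ExponentLE n d → ℝ) (b : ExponentLE n d) :
    coeff b.1 (ofCoeffs n d c) = c b := by
  simp only [ofCoeffs, LinearMap.sum_apply, LinearMap.comp_apply, LinearMap.proj_apply, coeff_sum,
    coeff_monomial]
  rw [Finset.sum_eq_single b (fun a _ hab => if_neg fun h => hab (Subtype.ext h)) (by simp)]
  simp

lemma coeff_ofCoeffs_of_lt {d : ℕ} (c : ExponentLE n d → ℝ) {b : Fin n →₀ ℕ} (hb : d < b.degree) :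
    coeff b (ofCoeffs n d c) = 0 := by
  simp only [ofCoeffs, LinearMap.sum_apply, LinearMap.comp_apply, LinearMap.proj_apply, coeff_sum,
    coeff_monomial]
  refine Finset.sum_eq_zero fun a _ => if_neg fun h => ?_
  have := a.2
  rw [h] at this
  omega

lemma ofCoeffs_coeff {d : ℕ} {p : MvPolynomial (Fin n) ℝ} (hp : p.totalDegree ≤ d) :
    ofCoeffs n d (fun a => coeff a.1 p) = p := by
  ext b
  rcases le_or_gt b.degree d with hb | hb
  · exact coeff_ofCoeffs _ ⟨b, hb⟩
  · rw [coeff_ofCoeffs_of_lt _ hb, coeff_eq_zero_of_totalDegree_lt]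
    rw [Finsupp.degree_apply] at hb
    omega

/-- If the zeros in the unit ball of a harmonic polynomial vanishing at the origin lie in a
sufficiently thin slab, then its linear part controls all of its coefficients. -/
lemma exists_coeff_le_of_slab (hn : 0 < n) (d : ℕ) :
    ∃ ε : ℝ, 0 < ε ∧ ∀ p : MvPolynomial (Fin n) ℝ, IsHarmonic p → p.totalDegree ≤ d →
      coeff 0 p = 0 → ∀ e : EuclideanSpace ℝ (Fin n), ‖e‖ = 1 →
      (∀ y, ‖y‖ ≤ 1 → evalPt p y = 0 → |inner ℝ e y| < ε) →
      ∀ a, ∃ i, ε * |coeff a p| ≤ |coeff (Finsupp.single i 1) p| := by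
  by_contra! hcon
  choose p hp hdeg h0 e he hz a ha using fun k : ℕ => hcon (1 / ((k : ℝ) + 1)) (by positivity)
  set c : ℕ → ExponentLE n d → ℝ := fun k b => coeff b.1 (p k) with hc
  have hca : ∀ k, |coeff (a k) (p k)| ≤ ‖c k‖ := by
    intro k
    rcases le_or_gt (a k).degree d with hb | hb
    · exact norm_le_pi_norm (c k) ⟨a k, hb⟩
    · rw [coeff_eq_zero_of_totalDegree_lt, abs_zero]
      · exact norm_nonneg _
      · rw [Finsupp.degree_apply] at hb
        exact (hdeg k).trans_lt hb
  have hcpos : ∀ k, 0 < ‖c k‖ := by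
    intro k
    refine lt_of_lt_of_le (abs_pos.2 fun h => ?_) (hca k)
    have := ha k ⟨0, hn⟩
    rw [h, abs_zero, mul_zero] at this
    exact absurd this (not_lt.2 (abs_nonneg _))
  set u : ℕ → ExponentLE n d → ℝ := fun k => ‖c k‖⁻¹ • c k with hu
  have hup : ∀ k, ofCoeffs n d (u k) = ‖c k‖⁻¹ • p k := fun k => by
    rw [hu, map_smul, hc, ofCoeffs_coeff (hdeg k)]
  have hu1 : ∀ k, ‖u k‖ = 1 := fun k => by
    rw [hu, norm_smul, norm_inv, norm_norm, inv_mul_cancel₀ (hcpos k).ne']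
  obtain ⟨⟨v, e'⟩, hve, φ, hφ, hlim⟩ := ((isCompact_sphere (0 : ExponentLE n d → ℝ) 1).prod
    (isCompact_sphere (0 : EuclideanSpace ℝ (Fin n)) 1)).tendsto_subseq (x := fun k => (u k, e k))
    fun k => ⟨by simpa using hu1 k, by simpa using he k⟩
  have hv1 : ‖v‖ = 1 := by simpa using hve.1
  have he1 : ‖e'‖ = 1 := by simpa using hve.2
  have hvlim : Tendsto (fun k => u (φ k)) atTop (𝓝 v) := (continuous_fst.tendsto _).comp hlim
  have helim : Tendsto (fun k => e (φ k)) atTop (𝓝 e') := (continuous_snd.tendsto _).comp hlim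
  have hεlim : Tendsto (fun k => 1 / ((φ k : ℝ) + 1)) atTop (𝓝 0) :=
    tendsto_one_div_add_atTop_nhds_zero_nat.comp hφ.tendsto_atTop
  have hfun : ∀ l : MvPolynomial (Fin n) ℝ →ₗ[ℝ] ℝ,
      Tendsto (fun k => ‖c (φ k)‖⁻¹ * l (p (φ k))) atTop (𝓝 (l (ofCoeffs n d v))) := by
    intro l
    have h1 := ((l.comp (ofCoeffs n d)).continuous_of_finiteDimensional.tendsto v).comp hvlim
    refine h1.congr fun k => ?_
    simp [hup]
  have hg : IsHarmonic (ofCoeffs n d v) := by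
    ext b
    set l : MvPolynomial (Fin n) ℝ →ₗ[ℝ] ℝ := (lcoeff ℝ b).comp
      (∑ i : Fin n, (pderiv i).toLinearMap.comp (pderiv i).toLinearMap) with hl
    have hlp : ∀ f, l f = coeff b (∑ i : Fin n, pderiv i (pderiv i f)) := fun f => by
      simp [hl, coeff_sum]
    rw [← hlp, coeff_zero]
    refine tendsto_nhds_unique (hfun l) ?_
    have : ∀ k, l (p (φ k)) = 0 := fun k => by
      rw [hlp, show ∑ i : Fin n, pderiv i (pderiv i (p (φ k))) = 0 from hp (φ k), coeff_zero]
    simp [this]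
  have hcoeff : ∀ b, Tendsto (fun k => ‖c (φ k)‖⁻¹ * coeff b (p (φ k))) atTop
      (𝓝 (coeff b (ofCoeffs n d v))) := fun b => hfun (lcoeff ℝ b)
  have hlow : ∀ b : Fin n →₀ ℕ, b.degree ≤ 1 → coeff b (ofCoeffs n d v) = 0 := by
    intro b hb
    refine tendsto_nhds_unique (hcoeff b) ?_
    rcases Nat.le_one_iff_eq_zero_or_eq_one.1 hb with hb | hb
    · rw [(Finsupp.degree_eq_zero_iff b).1 hb]
      simp [h0]
    · obtain ⟨i, rfl⟩ := exists_eq_single_of_degree_eq_one hb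
      refine squeeze_zero_norm (fun k => ?_) hεlim
      rw [norm_mul, norm_inv, norm_norm, Real.norm_eq_abs, inv_mul_le_iff₀ (hcpos _)]
      refine (ha (φ k) i).le.trans ?_
      rw [mul_comm]
      exact mul_le_mul_of_nonneg_right (hca _) (by positivity)
  have hsign : ∀ y y' : EuclideanSpace ℝ (Fin n), ‖y‖ ≤ 1 → ‖y'‖ ≤ 1 →
      0 < inner ℝ e' y * inner ℝ e' y' →
      0 ≤ evalPt (ofCoeffs n d v) y * evalPt (ofCoeffs n d v) y' := by
    intro y y' hy hy' hpos
    have hev : ∀ z : EuclideanSpace ℝ (Fin n),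
        Tendsto (fun k => ‖c (φ k)‖⁻¹ * evalPt (p (φ k)) z) atTop
          (𝓝 (evalPt (ofCoeffs n d v) z)) := fun z =>
      hfun (MvPolynomial.aeval (R := ℝ) (fun i => z i)).toLinearMap
    have hin : ∀ z : EuclideanSpace ℝ (Fin n),
        Tendsto (fun k => inner ℝ (e (φ k)) z) atTop (𝓝 (inner ℝ e' z)) := fun z =>
      helim.inner tendsto_const_nhds
    refine ge_of_tendsto ((hev y).mul (hev y')) ?_
    have hmain : ∀ᶠ k in atTop, 0 ≤ evalPt (p (φ k)) y * evalPt (p (φ k)) y' := by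
      rcases mul_pos_iff.1 hpos with ⟨h1, h2⟩ | ⟨h1, h2⟩
      · filter_upwards [hεlim.eventually_lt (hin y) h1, hεlim.eventually_lt (hin y') h2]
          with k hk hk'
        exact evalPt_mul_nonneg_of_le_inner (hz (φ k)) hy hy' hk.le hk'.le
      · filter_upwards [hεlim.eventually_lt (hin y).neg (neg_pos.2 h1),
          hεlim.eventually_lt (hin y').neg (neg_pos.2 h2)] with k hk hk'
        refine evalPt_mul_nonneg_of_le_inner (e := -e (φ k)) (ε := 1 / ((φ k : ℝ) + 1))
          (fun z hz1 hz2 => ?_) hy hy' ?_ ?_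
        · rw [inner_neg_left, abs_neg]
          exact hz (φ k) z hz1 hz2
        · rw [inner_neg_left]; exact hk.le
        · rw [inner_neg_left]; exact hk'.le
    filter_upwards [hmain] with k hk
    calc 0 ≤ (‖c (φ k)‖⁻¹ * ‖c (φ k)‖⁻¹) * (evalPt (p (φ k)) y * evalPt (p (φ k)) y') :=
          mul_nonneg (mul_self_nonneg _) hk
      _ = _ := by ring
  have hzero := eq_zero_of_sign_on_ball hg hlow he1 hsign
  have hv0 : v = 0 := by
    ext b
    rw [← coeff_ofCoeffs v b, hzero]
    simp
  rw [hv0, norm_zero] at hv1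
  exact zero_ne_one hv1

end Compactness

section FlatnessAndNorms

variable {n : ℕ}

lemma exists_slab_of_flatness_lt (hn : 0 < n) {A : Set (EuclideanSpace ℝ (Fin n))}
    {x : EuclideanSpace ℝ (Fin n)} (hx : x ∈ A) {r δ : ℝ} (hr : 0 < r)
    (h : flatness A x r < δ) :
    ∃ e : EuclideanSpace ℝ (Fin n), ‖e‖ = 1 ∧
      ∀ z ∈ A, z ∈ closedBall x r → |inner ℝ e (z - x)| < δ * r := by
  have hne : Nonempty {L : Submodule ℝ (EuclideanSpace ℝ (Fin n)) //
      Module.finrank ℝ L = n - 1} := by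
    have hv : (EuclideanSpace.single ⟨0, hn⟩ (1 : ℝ) : EuclideanSpace ℝ (Fin n)) ≠ 0 := by simp
    have h1 := Submodule.finrank_add_finrank_orthogonal
      (Submodule.span ℝ {(EuclideanSpace.single ⟨0, hn⟩ (1 : ℝ) : EuclideanSpace ℝ (Fin n))})
    rw [finrank_span_singleton hv, finrank_euclideanSpace_fin] at h1
    refine ⟨⟨(Submodule.span ℝ
      {(EuclideanSpace.single ⟨0, hn⟩ (1 : ℝ) : EuclideanSpace ℝ (Fin n))})ᗮ, ?_⟩⟩
    omega
  rw [flatness, one_div, inv_mul_lt_iff₀ hr, mul_comm] at h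
  obtain ⟨⟨L, hL⟩, hlt⟩ := exists_lt_of_ciInf_lt h
  have hLtop : Lᗮ ≠ ⊥ := by
    intro hbot
    have := L.finrank_add_finrank_orthogonal
    rw [hbot, hL, finrank_bot, finrank_euclideanSpace_fin] at this
    omega
  obtain ⟨w, hwL, hw⟩ := Submodule.exists_mem_ne_zero_of_ne_bot hLtop
  have hunit : ‖‖w‖⁻¹ • w‖ = 1 := by
    rw [norm_smul, norm_inv, norm_norm, inv_mul_cancel₀ (norm_ne_zero_iff.2 hw)]
  refine ⟨‖w‖⁻¹ • w, hunit, fun z hz hzr => ?_⟩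
  have hxball : x ∈ closedBall x r := mem_closedBall_self hr.le
  have hfin := hausdorffEDist_ne_top_of_nonempty_of_bounded
    (s := A ∩ closedBall x r)
    (t := ((fun y => x + y) '' (L : Set (EuclideanSpace ℝ (Fin n)))) ∩ closedBall x r)
    ⟨x, hx, hxball⟩ ⟨x, ⟨0, L.zero_mem, add_zero x⟩, hxball⟩
    (isBounded_closedBall.subset Set.inter_subset_right)
    (isBounded_closedBall.subset Set.inter_subset_right)
  obtain ⟨_, ⟨⟨y, hy, rfl⟩, -⟩, hdist⟩ := exists_dist_lt_of_hausdorffDist_lt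
    (Set.mem_inter hz hzr) hlt hfin
  have hy0 : inner ℝ (‖w‖⁻¹ • w) y = 0 := by
    rw [inner_smul_left, (Submodule.mem_orthogonal' L w).1 hwL y hy, mul_zero]
  have heq : inner ℝ (‖w‖⁻¹ • w) (z - x) = inner ℝ (‖w‖⁻¹ • w) (z - (x + y)) := by
    rw [← sub_sub, inner_sub_right _ (z - x), hy0, sub_zero]
  rw [heq]
  refine (abs_real_inner_le_norm _ _).trans_lt ?_
  rw [hunit, one_mul, ← dist_eq_norm]
  exact hdist

lemma abs_evalPt_le_sum_abs_coeff {d : ℕ} {f : MvPolynomial (Fin n) ℝ} (hf : f.totalDegree ≤ d)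
    {z : EuclideanSpace ℝ (Fin n)} (hz : ‖z‖ ≤ 1) :
    |evalPt f z| ≤ ∑ a : ExponentLE n d, |coeff a.1 f| := by
  have h : evalPt f z = ∑ a : ExponentLE n d, coeff a.1 f * ∏ i, z i ^ a.1 i := by
    conv_lhs => rw [evalPt, ← ofCoeffs_coeff hf]
    simp [ofCoeffs, eval_monomial_eq_prod]
  rw [h]
  refine (Finset.abs_sum_le_sum_abs _ _).trans (Finset.sum_le_sum fun a _ => ?_)
  rw [abs_mul, Finset.abs_prod]
  refine mul_le_of_le_one_right (abs_nonneg _)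
    (Finset.prod_le_one (fun _ _ => abs_nonneg _) fun i _ => ?_)
  rw [abs_pow]
  exact pow_le_one₀ (abs_nonneg _) ((PiLp.norm_apply_le z i).trans hz)

lemma support_dilatePoly_subset (p : MvPolynomial (Fin n) ℝ) (t : ℝ) :
    (dilatePoly p t).support ⊆ p.support := by
  intro a ha
  rw [mem_support_iff, coeff_dilatePoly] at ha
  exact mem_support_iff.2 (right_ne_zero_of_mul ha)

lemma supNormBall_homogeneousComponent_le {d : ℕ} {q : MvPolynomial (Fin n) ℝ}
    (hq : q.totalDegree ≤ d) {r : ℝ} (hr : 0 < r) (j : ℕ) :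
    supNormBall (homogeneousComponent j q) r
      ≤ ENNReal.ofReal (∑ a : ExponentLE n d, |coeff a.1 (dilatePoly q r)|) := by
  refine iSup₂_le fun y hy => ENNReal.ofReal_le_ofReal ?_
  have hy' : y = r • (r⁻¹ • y) := by rw [smul_smul, mul_inv_cancel₀ hr.ne', one_smul]
  have hsub : (homogeneousComponent j q).support ⊆ q.support := by
    intro a ha
    rw [mem_support_iff, coeff_homogeneousComponent] at ha
    exact mem_support_iff.2 fun h => ha (by simp [h])
  have hnorm : ‖r⁻¹ • y‖ ≤ 1 := by
    rw [norm_smul, norm_inv, Real.norm_of_nonneg hr.le, inv_mul_le_iff₀ hr, mul_one]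
    simpa using hy
  rw [hy', ← evalPt_dilatePoly]
  refine (abs_evalPt_le_sum_abs_coeff ((totalDegree_le_of_support_subset
    ((support_dilatePoly_subset _ _).trans hsub)).trans hq) hnorm).trans
    (Finset.sum_le_sum fun a _ => ?_)
  rw [coeff_dilatePoly, coeff_dilatePoly, coeff_homogeneousComponent]
  split_ifs
  · exact le_rfl
  · rw [mul_zero, abs_zero]
    exact abs_nonneg _

lemma le_supNormBall_homogeneousComponent_one (q : MvPolynomial (Fin n) ℝ) {r : ℝ} (hr : 0 < r)
    (i : Fin n) : ENNReal.ofReal |coeff (Finsupp.single i 1) (dilatePoly q r)|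
      ≤ supNormBall (homogeneousComponent 1 q) r := by
  have hmem : EuclideanSpace.single i r ∈ closedBall (0 : EuclideanSpace ℝ (Fin n)) r := by
    simp [abs_of_pos hr]
  refine le_trans (le_of_eq ?_) (le_iSup₂ (f := fun y _ =>
    ENNReal.ofReal |evalPt (homogeneousComponent 1 q) y|) _ hmem)
  congr 2
  rw [coeff_dilatePoly, Finsupp.degree_single, pow_one, evalPt, eval_eq',
    Finset.sum_eq_single (Finsupp.single i 1)]
  · rw [coeff_homogeneousComponent, if_pos (Finsupp.degree_single i 1), mul_comm,
      Finset.prod_eq_single i (fun k _ hk => by simp [hk.symm]) (by simp)]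
    simp
  · intro a ha hne
    rw [mem_support_iff, coeff_homogeneousComponent] at ha
    obtain ⟨k, rfl⟩ := exists_eq_single_of_degree_eq_one (ite_ne_right_iff.1 ha).1
    have hki : k ≠ i := fun h => hne (by rw [h])
    rw [Finset.prod_eq_zero (Finset.mem_univ k) (by simp [hki]), mul_zero]
  · intro h
    rw [notMem_support_iff.1 h, zero_mul]

lemma eval_pderiv_eq_coeff_translatePoly (p : MvPolynomial (Fin n) ℝ)
    (x : EuclideanSpace ℝ (Fin n)) (i : Fin n) :
    eval (fun j => x j) (pderiv i p) = coeff (Finsupp.single i 1) (translatePoly p x) := by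
  have h := coeff_pderiv (i := i) (translatePoly p x) 0
  rw [pderiv_translatePoly, zero_add] at h
  simp only [Finsupp.coe_zero, Pi.zero_apply, Nat.cast_zero, zero_add, mul_one] at h
  rw [← h]
  have h2 := evalPt_translatePoly (pderiv i p) x 0
  rw [add_zero] at h2
  change evalPt (pderiv i p) x = _
  rw [← h2, evalPt, ← constantCoeff_eq, ← eval_zero]
  rfl

end FlatnessAndNorms

/-- If the zero set of a harmonic polynomial of degree d is sufficiently flat at a root
at one scale, then ζ_1 is bounded there; in particular the gradient does not vanish. -/
theorem zeta_lt_of_flat (n d : ℕ) (hn : 2 ≤ n) (hd : 1 ≤ d) :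
    ∃ δ : ℝ, 0 < δ ∧ ∀ h : MvPolynomial (Fin n) ℝ, IsHarmonic h → h.totalDegree = d →
      ∀ x : EuclideanSpace ℝ (Fin n), evalPt h x = 0 →
      ∀ r > (0 : ℝ), flatness (zeroSet h) x r < δ →
        zeta d h x 1 r < ENNReal.ofReal δ⁻¹ ∧ gradNeZero h x := by
  obtain ⟨ε, hε, key⟩ := exists_coeff_le_of_slab (n := n) (by omega) d
  set N : ℝ := (Fintype.card (ExponentLE n d) : ℝ) with hN
  have hN0 : 0 ≤ N := Nat.cast_nonneg _
  refine ⟨ε / (N + 1), by positivity, fun h hh hdeg x hx r hr hflat => ?_⟩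
  obtain ⟨e, he, hslab⟩ := exists_slab_of_flatness_lt (by omega) (A := zeroSet h) hx hr hflat
  set q := translatePoly h x with hq
  set p := dilatePoly q r with hp
  have hqdeg : q.totalDegree ≤ d := hdeg ▸ totalDegree_translatePoly_le h x
  have hpdeg : p.totalDegree ≤ d :=
    (totalDegree_le_of_support_subset (support_dilatePoly_subset q r)).trans hqdeg
  have hpeval : ∀ y, evalPt p y = evalPt h (x + r • y) := fun y => by
    rw [hp, evalPt_dilatePoly, hq, evalPt_translatePoly]
  have hp0 : coeff 0 p = 0 := by
    have h1 := hpeval 0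
    rw [smul_zero, add_zero, hx] at h1
    rw [← constantCoeff_eq, ← eval_zero]
    exact h1
  have hδε : ε / (N + 1) ≤ ε := div_le_self hε.le (by linarith)
  have hslab' : ∀ y, ‖y‖ ≤ 1 → evalPt p y = 0 → |inner ℝ e y| < ε := by
    intro y hy hy0
    rw [hpeval] at hy0
    have h1 := hslab (x + r • y) hy0 (by
      rw [mem_closedBall, dist_self_add_left, norm_smul, Real.norm_of_nonneg hr.le]
      exact mul_le_of_le_one_right hr.le hy)
    rw [add_sub_cancel_left, inner_smul_right, abs_mul, abs_of_pos hr, mul_comm] at h1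
    exact (lt_of_mul_lt_mul_right h1 hr.le).trans_le hδε
  have hcoeff := key p ((hh.translatePoly x).dilatePoly r) hpdeg hp0 e he hslab'
  constructor
  · have hratio : ∀ j, supNormBall (homPart h x j) r / supNormBall (homPart h x 1) r
        ≤ ENNReal.ofReal (N / ε) := by
      intro j
      refine ENNReal.div_le_of_le_mul ?_
      refine (supNormBall_homogeneousComponent_le hqdeg hr j).trans ?_
      rw [ENNReal.ofReal_sum_of_nonneg fun _ _ => abs_nonneg _]
      have hterm : ∀ a : ExponentLE n d, ENNReal.ofReal |coeff a.1 p|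
          ≤ ENNReal.ofReal ε⁻¹ * supNormBall (homPart h x 1) r := by
        intro a
        obtain ⟨i, hi⟩ := hcoeff a.1
        refine le_trans ?_ (mul_le_mul_right (le_supNormBall_homogeneousComponent_one q hr i) _)
        rw [← ENNReal.ofReal_mul (by positivity)]
        refine ENNReal.ofReal_le_ofReal ?_
        rwa [le_inv_mul_iff₀ hε]
      refine (Finset.sum_le_sum fun a _ => hterm a).trans (le_of_eq ?_)
      rw [Finset.sum_const, Finset.card_univ, nsmul_eq_mul, ← mul_assoc, div_eq_mul_inv,
        ENNReal.ofReal_mul hN0, hN, ENNReal.ofReal_natCast]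
    refine (iSup₂_le fun j _ => hratio j).trans_lt ?_
    rw [inv_div, ENNReal.ofReal_lt_ofReal_iff (by positivity)]
    gcongr
    linarith
  · have hq0 : q ≠ 0 := by
      intro hq0
      have hzero : h = 0 := by
        refine MvPolynomial.funext fun y => ?_
        have h1 := evalPt_translatePoly h x (WithLp.toLp 2 y - x)
        rw [← hq, hq0, add_sub_cancel] at h1
        simpa [evalPt] using h1.symm
      rw [hzero, totalDegree_zero] at hdeg
      omega
    obtain ⟨a, ha⟩ := MvPolynomial.ne_zero_iff.1 hq0
    obtain ⟨i, hi⟩ := hcoeff a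
    refine ⟨i, fun hgrad => ?_⟩
    rw [eval_pderiv_eq_coeff_translatePoly, ← hq] at hgrad
    rw [hp, coeff_dilatePoly, coeff_dilatePoly, hgrad, mul_zero, abs_zero] at hi
    have : 0 < ε * |r ^ a.degree * coeff a q| := by positivity
    linarith
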